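/- In the discharging of H defined by rules R1–R5 applied to the initial charge (every j-face charged with weight j), every major face f of H has final weight w(f) ≥ 0. -/

import Mathlib

open scoped Classical

noncomputable section

/-- A plane embedding (drawing) of a simple graph: vertices are mapped to distinct
points of the plane, every edge is drawn as a simple arc joining the points of its two
endvertices, arcs contain no vertex points other than their endpoints, and two distinct
arcs meet only in common endpoints. -/
structure PlaneEmbedding {V : Type*} (G : SimpleGraph V) where
  pos : V → ℝ × ℝ
  arc : V → V → Set (ℝ × ℝ)
  pos_injective : Function.Injective pos
  arc_symm : ∀ u v, arc u v = arc v u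
  arc_curve : ∀ u v, G.Adj u v → ∃ γ : ℝ → ℝ × ℝ,
      ContinuousOn γ (Set.Icc 0 1) ∧ Set.InjOn γ (Set.Icc 0 1) ∧
      γ 0 = pos u ∧ γ 1 = pos v ∧ γ '' Set.Icc 0 1 = arc u v
  arc_vertex : ∀ u v, G.Adj u v → ∀ w, pos w ∈ arc u v → w = u ∨ w = v
  arc_inter : ∀ u v x y, G.Adj u v → G.Adj x y → s(u, v) ≠ s(x, y) →
      arc u v ∩ arc x y ⊆ Set.range pos

/-- A graph is planar if it admits a plane embedding. -/
def SimpleGraph.IsPlanar {V : Type*} (G : SimpleGraph V) : Prop :=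
  Nonempty (PlaneEmbedding G)

/-- A graph is 3-connected if it has at least four vertices and deleting any set of at
most two vertices leaves a connected graph. -/
def ThreeConnected {V : Type*} [Fintype V] (G : SimpleGraph V) : Prop :=
  4 ≤ Fintype.card V ∧
    ∀ S : Finset V, S.card ≤ 2 → (G.induce ((↑S : Set V)ᶜ)).Connected

/-- `S` is a separator of `G`: deleting it leaves a disconnected graph. -/
def IsSeparator {V : Type*} [Fintype V] (G : SimpleGraph V) (S : Finset V) : Prop :=
  ¬ (G.induce ((↑S : Set V)ᶜ)).Connected

/-- A separator `S` is trivial if some component of `G - S` is a single vertex, i.e.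
some vertex outside `S` has all of its neighbours inside `S`. -/
def TrivialSeparator {V : Type*} [Fintype V] (G : SimpleGraph V) (S : Finset V) : Prop :=
  ∃ v : V, v ∉ S ∧ ∀ w : V, G.Adj v w → w ∈ S

/-- A graph is essentially 4-connected if it is 3-connected and every 3-separator is
trivial. -/
def EssentiallyFourConnected {V : Type*} [Fintype V] (G : SimpleGraph V) : Prop :=
  ThreeConnected G ∧
    ∀ S : Finset V, S.card = 3 → IsSeparator G S → TrivialSeparator G S

/-- A cycle `C` of `G` is isolating if every component of `G - V(C)` is a single vertex
of degree 3 in `G`, i.e. every vertex not on `C` has degree 3 in `G` and all of its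
neighbours on `C`. -/
def IsIsolating {V : Type*} [Fintype V] (G : SimpleGraph V) {x : V} (C : G.Walk x x) : Prop :=
  ∀ v : V, v ∉ C.support →
    (Finset.univ.filter fun w => G.Adj v w).card = 3 ∧ ∀ w : V, G.Adj v w → w ∈ C.support

/-- `C` is a longest isolating cycle of `G`. -/
def IsLongestIsolatingCycle {V : Type*} [Fintype V] (G : SimpleGraph V) {x : V}
    (C : G.Walk x x) : Prop :=
  C.IsCycle ∧ IsIsolating G C ∧
    ∀ (y : V) (C' : G.Walk y y), C'.IsCycle → IsIsolating G C' → C'.length ≤ C.length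

section PlaneSetup

variable {V : Type*} [Fintype V] {G : SimpleGraph V}

/-- The chords of the cycle `C`: edges of `G` not on `C` joining two vertices of `C`. -/
def chordSet {x : V} (C : G.Walk x x) : Set (Sym2 V) :=
  {e | e ∈ G.edgeSet ∧ e ∉ C.edges ∧ ∀ v ∈ e, v ∈ C.support}

/-- The plane graph `H` obtained from `G` by deleting all chords of `C`. -/
def Hgraph {x : V} (C : G.Walk x x) : SimpleGraph V :=
  G.deleteEdges (chordSet C)

/-- The arc drawing an edge, as a function of the unordered edge. -/
def arcSet (emb : PlaneEmbedding G) : Sym2 V → Set (ℝ × ℝ) :=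
  Sym2.lift ⟨emb.arc, emb.arc_symm⟩

/-- The point set of the drawing of the subgraph of `H'` induced on the vertex set `s`
(in the embedding `emb` of `G`). -/
def drawingOn (emb : PlaneEmbedding G) (H' : SimpleGraph V) (s : Set V) : Set (ℝ × ℝ) :=
  emb.pos '' s ∪
    ⋃ (u : V) (v : V) (_ : H'.Adj u v) (_ : u ∈ s) (_ : v ∈ s), emb.arc u v

/-- The drawing of `H`. -/
def drawingH (emb : PlaneEmbedding G) {x : V} (C : G.Walk x x) : Set (ℝ × ℝ) :=
  drawingOn emb (Hgraph C) Set.univ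

/-- `f` is a face of the drawing `D`: a connected component of its complement. -/
def IsFaceOf (D : Set (ℝ × ℝ)) (f : Set (ℝ × ℝ)) : Prop :=
  ∃ z : ℝ × ℝ, z ∉ D ∧ f = connectedComponentIn Dᶜ z

/-- The drawing of the cycle `C`. -/
def drawC (emb : PlaneEmbedding G) {x : V} (C : G.Walk x x) : Set (ℝ × ℝ) :=
  ⋃ e ∈ C.edges, arcSet emb e

/-- The open region strictly inside the closed curve given by `C`: the points off the
curve whose connected component in the complement is bounded. -/
def insideC (emb : PlaneEmbedding G) {x : V} (C : G.Walk x x) : Set (ℝ × ℝ) :=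
  {z | z ∉ drawC emb C ∧ Bornology.IsBounded (connectedComponentIn (drawC emb C)ᶜ z)}

/-- The vertices of `G` strictly inside `C`. -/
def Vminus (emb : PlaneEmbedding G) {x : V} (C : G.Walk x x) : Finset V :=
  Finset.univ.filter fun v => v ∉ C.support ∧ emb.pos v ∈ insideC emb C

/-- The vertices of `G` strictly outside `C`:  `V⁺ = V - V(C) - V⁻`. -/
def Vplus (emb : PlaneEmbedding G) {x : V} (C : G.Walk x x) : Finset V :=
  Finset.univ.filter fun v => v ∉ C.support ∧ v ∉ Vminus emb C

/-- A face `f` is incident with the vertex `v`. -/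
def incVertex (emb : PlaneEmbedding G) (f : Set (ℝ × ℝ)) (v : V) : Prop :=
  emb.pos v ∈ closure f

/-- A face `f` is incident with the edge `e` (the arc of `e` lies on the boundary). -/
def incEdge (emb : PlaneEmbedding G) (f : Set (ℝ × ℝ)) (e : Sym2 V) : Prop :=
  arcSet emb e ⊆ closure f

/-- A minor face of the drawing `D`: a face incident with exactly one vertex of
`V⁻ ∪ V⁺`. -/
def MinorFaceOf (emb : PlaneEmbedding G) {x : V} (C : G.Walk x x)
    (D : Set (ℝ × ℝ)) (f : Set (ℝ × ℝ)) : Prop :=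
  IsFaceOf D f ∧ ∃! v : V, v ∈ Vminus emb C ∪ Vplus emb C ∧ incVertex emb f v

/-- `M⁻`: the minor faces of `H⁻ = H - V⁺`. -/
def Mminus (emb : PlaneEmbedding G) {x : V} (C : G.Walk x x) : Set (Set (ℝ × ℝ)) :=
  {f | MinorFaceOf emb C (drawingOn emb (Hgraph C) ((↑(Vplus emb C) : Set V)ᶜ)) f}

/-- `M⁺`: the minor faces of `H⁺ = H - V⁻`. -/
def Mplus (emb : PlaneEmbedding G) {x : V} (C : G.Walk x x) : Set (Set (ℝ × ℝ)) :=
  {f | MinorFaceOf emb C (drawingOn emb (Hgraph C) ((↑(Vminus emb C) : Set V)ᶜ)) f}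

/-- A minor face of `H`. -/
def MinorFaceH (emb : PlaneEmbedding G) {x : V} (C : G.Walk x x) (f : Set (ℝ × ℝ)) : Prop :=
  MinorFaceOf emb C (drawingH emb C) f

/-- A major face of `H`: a face of `H` that is not minor. -/
def MajorFaceH (emb : PlaneEmbedding G) {x : V} (C : G.Walk x x) (f : Set (ℝ × ℝ)) : Prop :=
  IsFaceOf (drawingH emb C) f ∧ ¬ MinorFaceH emb C f

/-- The number of `C`-edges of a face `f` (so `f` is a `j`-face when this equals `j`). -/
def numCEdges (emb : PlaneEmbedding G) {x : V} (C : G.Walk x x) (f : Set (ℝ × ℝ)) : ℕ :=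
  (C.edges.toFinset.filter fun e => incEdge emb f e).card

/-- `m_{f,f'}`: the number of common `C`-edges of the faces `f` and `f'`. -/
def mEdges (emb : PlaneEmbedding G) {x : V} (C : G.Walk x x)
    (f f' : Set (ℝ × ℝ)) : ℕ :=
  (C.edges.toFinset.filter fun e => incEdge emb f e ∧ incEdge emb f' e).card

/-- `f'` is opposite to `f` (with respect to some `C`-edge incident with both). -/
def OppositeFaces (emb : PlaneEmbedding G) {x : V} (C : G.Walk x x)
    (f f' : Set (ℝ × ℝ)) : Prop :=
  f ≠ f' ∧ ∃ e ∈ C.edges, incEdge emb f e ∧ incEdge emb f' e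

/-- `e` is the middle `C`-edge of the face `f` (for a 3-face, the `C`-edge sharing an
endvertex with every other `C`-edge of `f`). -/
def IsMiddleCEdge (emb : PlaneEmbedding G) {x : V} (C : G.Walk x x)
    (f : Set (ℝ × ℝ)) (e : Sym2 V) : Prop :=
  e ∈ C.edges ∧ incEdge emb f e ∧
    ∀ e' ∈ C.edges, incEdge emb f e' → e' ≠ e → ∃ v : V, v ∈ e ∧ v ∈ e'

/-- The total weight sent from the face `f` to the face `f'` by the discharging rules
R1–R5 (each rule applied exactly once). -/
def sendWeight (emb : PlaneEmbedding G) {x : V} (C : G.Walk x x)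
    (f f' : Set (ℝ × ℝ)) : ℚ :=
  -- R1: a major face sends `m_{f,f'}` to every opposite minor face
  (if MajorFaceH emb C f ∧ MinorFaceH emb C f' ∧ OppositeFaces emb C f f'
    then (mEdges emb C f f' : ℚ) else 0)
  -- R2: a minor face sends `(2/3)·m_{f,f'}` to every opposite minor 2-face
  + (if MinorFaceH emb C f ∧ MinorFaceH emb C f' ∧ numCEdges emb C f' = 2 ∧
        OppositeFaces emb C f f'
    then 2 / 3 * (mEdges emb C f f' : ℚ) else 0)
  -- R3: a minor face sends 1 to every minor 3-face opposite with respect to its middle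
  -- `C`-edge
  + (if MinorFaceH emb C f ∧ MinorFaceH emb C f' ∧ numCEdges emb C f' = 3 ∧ f ≠ f' ∧
        (∃ e : Sym2 V, IsMiddleCEdge emb C f' e ∧ incEdge emb f e)
    then 1 else 0)
  -- R4
  + (if MinorFaceH emb C f ∧ 4 ≤ numCEdges emb C f ∧ MinorFaceH emb C f' ∧
        numCEdges emb C f' = 4 ∧ OppositeFaces emb C f' f ∧ mEdges emb C f' f = 2 ∧
        (∃ f₂ : Set (ℝ × ℝ), MinorFaceH emb C f₂ ∧
          (numCEdges emb C f₂ = 2 ∨ numCEdges emb C f₂ = 3) ∧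
          OppositeFaces emb C f' f₂ ∧ mEdges emb C f' f₂ = 2)
    then 2 / 3 else 0)
  -- R5
  + (if MinorFaceH emb C f ∧ 4 ≤ numCEdges emb C f ∧ MinorFaceH emb C f' ∧
        numCEdges emb C f' = 5 ∧ OppositeFaces emb C f' f ∧ mEdges emb C f' f = 2 ∧
        (∃ g₁ g₂ : Set (ℝ × ℝ), g₁ ≠ g₂ ∧
          MinorFaceH emb C g₁ ∧ numCEdges emb C g₁ = 2 ∧ OppositeFaces emb C f' g₁ ∧
          MinorFaceH emb C g₂ ∧ numCEdges emb C g₂ = 2 ∧ OppositeFaces emb C f' g₂)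
    then 1 / 3 else 0)

/-- The final weight of a face `f` after discharging: the initial charge `j` of a
`j`-face, minus everything sent, plus everything received. -/
def wFace (emb : PlaneEmbedding G) {x : V} (C : G.Walk x x) (f : Set (ℝ × ℝ)) : ℚ :=
  (numCEdges emb C f : ℚ) - (∑ᶠ f' : Set (ℝ × ℝ), sendWeight emb C f f')
    + ∑ᶠ f' : Set (ℝ × ℝ), sendWeight emb C f' f

end PlaneSetup

/-- `f` admits a continuous logarithm on `S`. -/
def HasLogOn (f : ℂ → ℂ) (S : Set ℂ) : Prop :=
  ∃ g : ℂ → ℂ, ContinuousOn g S ∧ ∀ z ∈ S, Complex.exp (g z) = f z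

namespace HasLogOn

variable {f f' : ℂ → ℂ} {S : Set ℂ}

theorem congr (h : HasLogOn f S) (hf : ∀ z ∈ S, f z = f' z) : HasLogOn f' S := by
  obtain ⟨g, hg, hgf⟩ := h
  exact ⟨g, hg, fun z hz => (hgf z hz).trans (hf z hz)⟩

theorem inv (h : HasLogOn f S) : HasLogOn (fun z => (f z)⁻¹) S := by
  obtain ⟨g, hg, hgf⟩ := h
  exact ⟨fun z => -g z, hg.neg, fun z hz => by rw [Complex.exp_neg, hgf z hz]⟩

theorem mul (h : HasLogOn f S) (h' : HasLogOn f' S) : HasLogOn (fun z => f z * f' z) S := by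
  obtain ⟨g, hg, hgf⟩ := h
  obtain ⟨g', hg', hgf'⟩ := h'
  exact ⟨fun z => g z + g' z, hg.add hg',
    fun z hz => by rw [Complex.exp_add, hgf z hz, hgf' z hz]⟩

end HasLogOn

/-- A nonvanishing continuous function on a simply connected, locally path connected space has
a continuous logarithm. -/
theorem exists_continuous_log {X : Type*} [TopologicalSpace X] [LocallyPathConnectedSpace X]
    [SimplyConnectedSpace X] {f : X → ℂ} (hf : Continuous f) (h0 : ∀ z, f z ≠ 0) :
    ∃ g : X → ℂ, Continuous g ∧ ∀ z, Complex.exp (g z) = f z := by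
  obtain ⟨x₀⟩ : Nonempty X := inferInstance
  obtain ⟨g, ⟨-, hg⟩, -⟩ := Complex.isCoveringMapOn_exp.existsUnique_continuousMap_lifts
    (⟨f, hf⟩ : C(X, ℂ)) (Complex.exp_log (h0 x₀)) (fun x => h0 x)
  exact ⟨g, g.continuous, fun z => congrFun hg z⟩

/-- A nonvanishing function that is continuous on a simple arc has a continuous logarithm
there. -/
theorem hasLogOn_arc {f : ℂ → ℂ} {γ : ℝ → ℂ} (hγ : ContinuousOn γ (Set.Icc 0 1))
    (hinj : Set.InjOn γ (Set.Icc 0 1)) (hf : ContinuousOn f (γ '' Set.Icc 0 1))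
    (h0 : ∀ z ∈ γ '' Set.Icc 0 1, f z ≠ 0) : HasLogOn f (γ '' Set.Icc 0 1) := by
  let e : Set.Icc (0 : ℝ) 1 → ℂ := fun t => γ t
  have hec : Continuous e := continuousOn_iff_continuous_domRestrict.mp hγ
  have hei : Function.Injective e := fun s t hst => Subtype.ext (hinj s.2 t.2 hst)
  have he : Topology.IsClosedEmbedding e := hec.isClosedEmbedding hei
  have hfγ : Continuous (fun t : ℝ => f (e (Set.projIcc 0 1 zero_le_one t))) :=
    hf.comp_continuous (hec.comp continuous_projIcc) fun t => ⟨_, Subtype.prop _, rfl⟩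
  obtain ⟨ψ, hψ, hψf⟩ := exists_continuous_log hfγ fun t => h0 _ ⟨_, Subtype.prop _, rfl⟩
  obtain ⟨g, hg⟩ := ContinuousMap.exists_extension' he
    (⟨fun t => ψ t, hψ.comp continuous_subtype_val⟩ : C(Set.Icc (0 : ℝ) 1, ℂ))
  refine ⟨g, g.continuous.continuousOn, ?_⟩
  rintro _ ⟨t, ht, rfl⟩
  have : g (γ t) = ψ t := congrFun hg ⟨t, ht⟩
  rw [this, hψf, Set.projIcc_of_mem _ ht]

/-- Points that are not separated by the closed set `K` have `(z - p) / (z - q)` with a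
continuous logarithm on `K`. -/
theorem hasLogOn_div_of_isPreconnected {K t : Set ℂ} (hK : IsClosed K) (ht : IsPreconnected t)
    (htK : t ⊆ Kᶜ) {p q : ℂ} (hp : p ∈ t) (hq : q ∈ t) :
    HasLogOn (fun z => (z - p) / (z - q)) K := by
  have hne : ∀ p ∈ t, ∀ z ∈ K, z - p ≠ 0 := fun p hp z hz h =>
    htK hp (sub_eq_zero.mp h ▸ hz)
  refine ht.induction₂' (fun p q => p ∈ t → q ∈ t → HasLogOn (fun z => (z - p) / (z - q)) K)
    ?_ ?_ hp hq hp hq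
  · intro x hx
    obtain ⟨r, hr, hball⟩ := Metric.isOpen_iff.mp hK.isOpen_compl x (htK hx)
    filter_upwards [mem_nhdsWithin_of_mem_nhds (Metric.ball_mem_nhds x hr)] with y hy
    have key : y ∈ t → HasLogOn (fun z => (z - y) / (z - x)) K := by
      intro hyt
      have hslit : ∀ z ∈ K, (z - y) / (z - x) ∈ Complex.slitPlane := by
        intro z hz
        have hzx : z - x ≠ 0 := hne x hx z hz
        have hzr : r ≤ ‖z - x‖ := by
          by_contra! h
          exact hball (mem_ball_iff_norm.mpr h) hz
        have hlt : ‖(x - y) / (z - x)‖ < 1 := by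
          rw [norm_div, div_lt_one (norm_pos_iff.mpr hzx), norm_sub_rev]
          exact (mem_ball_iff_norm.mp hy).trans_le hzr
        have : (z - y) / (z - x) = 1 + (x - y) / (z - x) := by
          field_simp
          ring
        exact this ▸ Complex.mem_slitPlane_of_norm_lt_one hlt
      refine ⟨fun z => Complex.log ((z - y) / (z - x)), ?_, fun z hz =>
        Complex.exp_log (Complex.slitPlane_ne_zero (hslit z hz))⟩
      refine ContinuousOn.clog ?_ hslit
      exact ContinuousOn.div (by fun_prop) (by fun_prop) (hne x hx)
    exact ⟨fun _ h => (key h).inv.congr fun z _ => inv_div _ _, fun h _ => key h⟩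
  · intro x y z hx hy hz hxy hyz _ _
    exact ((hxy hx hy).mul (hyz hy hz)).congr fun w hw => div_mul_div_cancel₀ (hne y hy w hw)


/-- If `p` lies in a bounded complementary component `U` of the compact set `K` and `q` does not
vanish on `U ∪ K`, then `(z - p) ^ m * q z` has a continuous logarithm on `K` only for `m = 0`. -/
theorem exponent_eq_zero_of_hasLogOn {K : Set ℂ} (hK : IsCompact K) {p : ℂ} (hp : p ∉ K)
    (hb : Bornology.IsBounded (connectedComponentIn Kᶜ p)) {m : ℤ} {q : ℂ → ℂ}
    (hq : ContinuousOn q (connectedComponentIn Kᶜ p ∪ K))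
    (hq0 : ∀ z ∈ connectedComponentIn Kᶜ p ∪ K, q z ≠ 0)
    (hlog : HasLogOn (fun z => (z - p) ^ m * q z) K) : m = 0 := by
  set U := connectedComponentIn Kᶜ p with hU
  have hUo : IsOpen U := hK.isClosed.isOpen_compl.connectedComponentIn
  have hpU : p ∈ U := mem_connectedComponentIn hp
  have hUK : U ⊆ Kᶜ := connectedComponentIn_subset _ _
  have hcl : closure U ⊆ U ∪ K := by
    intro z hz
    by_contra hzUK
    rw [Set.mem_union, not_or] at hzUK
    have hpre : IsPreconnected (insert z U) :=
      isPreconnected_connectedComponentIn.subset_closure (Set.subset_insert _ _)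
        (Set.insert_subset hz subset_closure)
    exact hzUK.1 (hpre.subset_connectedComponentIn (Set.mem_insert_of_mem _ hpU)
      (Set.insert_subset hzUK.2 hUK) (Set.mem_insert _ _))
  obtain ⟨g, hg, hgq⟩ := hlog
  obtain ⟨h, hh⟩ := ContinuousMap.exists_extension' hK.isClosed.isClosedEmbedding_subtypeVal
    (⟨fun t => g t, continuousOn_iff_continuous_domRestrict.mp hg⟩ : C(K, ℂ))
  have hhq : ∀ z ∈ K, Complex.exp (h z) = (z - p) ^ m * q z := fun z hz => by
    refine Eq.trans ?_ (hgq z hz); exact congrArg _ (congrFun hh ⟨z, hz⟩)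
  let Φ : ℂ → ℂ := fun z => if z ∈ U then Complex.exp (h z) / q z else (z - p) ^ m
  have hΦ : Continuous Φ := by
    refine continuous_if ?_ ?_ ?_
    · intro z hz
      have hzK : z ∈ K := by
        rw [Set.ofPred_mem_eq, hUo.frontier_eq] at hz
        exact (hcl hz.1).resolve_left hz.2
      rw [hhq z hzK, mul_div_cancel_right₀ _ (hq0 z (Or.inr hzK))]
    · exact ContinuousOn.div (by fun_prop) (hq.mono hcl) fun z hz => hq0 z (hcl hz)
    · have : closure {z | z ∉ U} = Uᶜ := hUo.isClosed_compl.closure_eq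
      rw [this]
      refine ContinuousOn.zpow₀ (by fun_prop) m fun z hz => Or.inl fun h0 => hz ?_
      rwa [sub_eq_zero.mp h0]
  have hΦ0 : ∀ z, Φ z ≠ 0 := by
    intro z
    by_cases hz : z ∈ U
    · simpa [Φ, hz] using hq0 z (Or.inl hz)
    · have : z - p ≠ 0 := fun h0 => hz (by rwa [sub_eq_zero.mp h0])
      simpa [Φ, hz] using zpow_ne_zero m this
  obtain ⟨ψ, hψ, hψΦ⟩ := exists_continuous_log hΦ hΦ0
  obtain ⟨r, hr⟩ := hb.subset_ball p
  have hr0 : 0 < r := by simpa using hr hpU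
  have hout : ∀ t : ℝ, Φ (p + r * Complex.exp (t * Complex.I)) =
      r ^ m * Complex.exp (m * (t * Complex.I)) := by
    intro t
    have : p + r * Complex.exp (t * Complex.I) ∉ U := fun hmem => by
      have := hr hmem
      simp [Complex.norm_exp_ofReal_mul_I, abs_of_pos hr0] at this
    simp only [Φ, if_neg this, add_sub_cancel_left, mul_zpow, Complex.exp_int_mul]
  have hlift : (fun t : ℝ => ψ (p + r * Complex.exp (t * Complex.I))) =
      fun t : ℝ => m * (t * Complex.I) + ψ (p + r) := by
    refine Complex.isCoveringMap_exp.eq_of_comp_eq (by fun_prop) (by fun_prop) ?_ 0 (by simp)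
    ext t
    have h0 := hout 0
    simp only [Complex.ofReal_zero, zero_mul, Complex.exp_zero, mul_one, mul_zero] at h0
    simp only [Function.comp_apply, hψΦ, hout, Complex.exp_add, h0]
    ring
  have h2 := congrFun hlift (2 * Real.pi)
  simp only [Complex.ofReal_mul, Complex.ofReal_ofNat, Complex.exp_two_pi_mul_I, mul_one] at h2
  have : (m : ℂ) * (2 * Real.pi * Complex.I) = 0 := by linear_combination -h2
  simpa [Complex.two_pi_I_ne_zero] using this

/-- A bounded set has at most one unbounded complementary component. -/
theorem isBounded_or_isBounded_connectedComponentIn {K : Set ℂ} (hK : Bornology.IsBounded K)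
    {p q : ℂ} (hpq : q ∉ connectedComponentIn Kᶜ p) (hq : q ∉ K) :
    Bornology.IsBounded (connectedComponentIn Kᶜ p) ∨
      Bornology.IsBounded (connectedComponentIn Kᶜ q) := by
  obtain ⟨r, hr0, hr⟩ := hK.exists_pos_norm_le
  have hout : IsPreconnected {z : ℂ | r < ‖z‖} := by
    have : {z : ℂ | r < ‖z‖} = Complex.exp '' {z | Real.log r < z.re} := by
      ext z
      constructor
      · intro (hz : r < ‖z‖)
        have hz0 : z ≠ 0 := norm_pos_iff.mp (hr0.trans hz)
        exact ⟨Complex.log z, by simpa [Complex.log_re] using Real.log_lt_log hr0 hz,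
          Complex.exp_log hz0⟩
      · rintro ⟨w, hw, rfl⟩
        simpa [Complex.norm_exp] using (Real.log_lt_iff_lt_exp hr0).mp hw
    rw [this]
    exact (convex_halfSpace_re_gt _).isPreconnected.image _ Complex.continuous_exp.continuousOn
  have houtK : {z : ℂ | r < ‖z‖} ⊆ Kᶜ := fun z hz hzK => (hr z hzK).not_gt hz
  have hsub : ∀ x : ℂ, ¬ Bornology.IsBounded (connectedComponentIn Kᶜ x) →
      {z : ℂ | r < ‖z‖} ⊆ connectedComponentIn Kᶜ x := by
    intro x hx
    obtain ⟨z, hz, hzr⟩ : ∃ z ∈ connectedComponentIn Kᶜ x, r < ‖z‖ := by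
      by_contra! h
      exact hx (isBounded_iff_forall_norm_le.mpr ⟨r, h⟩)
    rw [connectedComponentIn_eq hz]
    exact hout.subset_connectedComponentIn hzr houtK
  by_contra! h
  have hw : ((r + 1 : ℝ) : ℂ) ∈ {z : ℂ | r < ‖z‖} := by
    simp only [Set.mem_ofPred_eq, Complex.norm_real, Real.norm_eq_abs]
    exact (lt_add_one r).trans_le (le_abs_self _)
  have hp' := connectedComponentIn_eq (hsub p h.1 hw)
  have hq' := connectedComponentIn_eq (hsub q h.2 hw)
  exact hpq (hp'.trans hq'.symm ▸ mem_connectedComponentIn hq)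

/-- `f` has continuous logarithms on `K` and on `L` whose differences at `a` and at `b`
differ by `n` full turns. -/
def LogJump (f : ℂ → ℂ) (K L : Set ℂ) (a b : ℂ) (n : ℤ) : Prop :=
  ∃ g h : ℂ → ℂ, ContinuousOn g K ∧ ContinuousOn h L ∧
    (∀ z ∈ K, Complex.exp (g z) = f z) ∧ (∀ z ∈ L, Complex.exp (h z) = f z) ∧
    g a - h a - (g b - h b) = n * (2 * Real.pi * Complex.I)

theorem HasLogOn.exists_logJump {f : ℂ → ℂ} {K L : Set ℂ} {a b : ℂ} (hK : HasLogOn f K)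
    (hL : HasLogOn f L) (ha : a ∈ K ∩ L) (hb : b ∈ K ∩ L) : ∃ n : ℤ, LogJump f K L a b n := by
  obtain ⟨g, hg, hgf⟩ := hK
  obtain ⟨h, hh, hhf⟩ := hL
  obtain ⟨k, hk⟩ := Complex.exp_eq_exp_iff_exists_int.mp ((hgf a ha.1).trans (hhf a ha.2).symm)
  obtain ⟨l, hl⟩ := Complex.exp_eq_exp_iff_exists_int.mp ((hgf b hb.1).trans (hhf b hb.2).symm)
  refine ⟨k - l, g, h, hg, hh, hgf, hhf, ?_⟩
  push_cast
  linear_combination hk - hl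

namespace LogJump

variable {f f' : ℂ → ℂ} {K L : Set ℂ} {a b : ℂ} {n n' : ℤ}

theorem zpow_mul_zpow (hf : LogJump f K L a b n) (hf' : LogJump f' K L a b n') (x y : ℤ) :
    LogJump (fun z => f z ^ x * f' z ^ y) K L a b (x * n + y * n') := by
  obtain ⟨g, h, hg, hh, hgf, hhf, hn⟩ := hf
  obtain ⟨g', h', hg', hh', hgf', hhf', hn'⟩ := hf'
  refine ⟨fun z => x * g z + y * g' z, fun z => x * h z + y * h' z, by fun_prop, by fun_prop,
    fun z hz => ?_, fun z hz => ?_, ?_⟩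
  · rw [Complex.exp_add, Complex.exp_int_mul, Complex.exp_int_mul, hgf z hz, hgf' z hz]
  · rw [Complex.exp_add, Complex.exp_int_mul, Complex.exp_int_mul, hhf z hz, hhf' z hz]
  · push_cast
    linear_combination x * hn + y * hn'

theorem hasLogOn_union (hf : LogJump f K L a b 0) (hK : IsClosed K) (hL : IsClosed L)
    (ha : a ∈ K ∩ L) (hKL : K ∩ L ⊆ {a, b}) : HasLogOn f (K ∪ L) := by
  obtain ⟨g, h, hg, hh, hgf, hhf, hn⟩ := hf
  have hglue : ∀ z ∈ K, z ∈ L → h z + (g a - h a) = g z := by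
    intro z hzK hzL
    rcases hKL ⟨hzK, hzL⟩ with rfl | hz
    · ring
    · rw [Set.mem_singleton_iff.mp hz]
      push_cast at hn
      linear_combination hn
  have hexp : Complex.exp (g a - h a) = 1 := by
    rw [Complex.exp_sub, hgf a ha.1, hhf a ha.2, div_self]
    exact hgf a ha.1 ▸ Complex.exp_ne_zero _
  let F : ℂ → ℂ := fun z => if z ∈ K then g z else h z + (g a - h a)
  have hFK : ∀ z ∈ K, F z = g z := fun z hz => if_pos hz
  have hFL : ∀ z ∈ L, F z = h z + (g a - h a) := fun z hz => by
    by_cases hzK : z ∈ K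
    · rw [hFK z hzK, hglue z hzK hz]
    · exact if_neg hzK
  refine ⟨F, ContinuousOn.union_of_isClosed (hg.congr hFK)
    ((hh.add continuousOn_const).congr hFL) hK hL, ?_⟩
  rintro z (hz | hz)
  · rw [hFK z hz, hgf z hz]
  · rw [hFL z hz, Complex.exp_add, hexp, mul_one, hhf z hz]

end LogJump

/-- Attaching an arc at its two ends to a compact set `K` splits a component of the complement
of `K` into at most two components. -/
theorem not_three_components_of_arc {K t : Set ℂ} {γ : ℝ → ℂ} (hK : IsCompact K)
    (hγ : ContinuousOn γ (Set.Icc 0 1)) (hinj : Set.InjOn γ (Set.Icc 0 1))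
    (hγ0 : γ 0 ∈ K) (hγ1 : γ 1 ∈ K) (hKγ : K ∩ γ '' Set.Icc 0 1 ⊆ {γ 0, γ 1})
    (ht : IsPreconnected t) (htK : t ⊆ Kᶜ) {p : Fin 3 → ℂ} (hpt : ∀ i, p i ∈ t)
    (hpγ : ∀ i, p i ∉ γ '' Set.Icc 0 1)
    (hp : ∀ i j, i ≠ j → p j ∉ connectedComponentIn (K ∪ γ '' Set.Icc 0 1)ᶜ (p i)) : False := by
  set L := γ '' Set.Icc 0 1 with hL
  have hLc : IsCompact L := isCompact_Icc.image_of_continuousOn hγ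
  have hD : IsCompact (K ∪ L) := hK.union hLc
  have hpD : ∀ i, p i ∉ K ∪ L := fun i h => h.elim (htK (hpt i)) (hpγ i)
  have ha : γ 0 ∈ K ∩ L := ⟨hγ0, 0, by simp, rfl⟩
  have hb : γ 1 ∈ K ∩ L := ⟨hγ1, 1, by simp, rfl⟩
  have hne : ∀ i, ∀ z ∈ K ∪ L, z - p i ≠ 0 := fun i z hz h =>
    hpD i (sub_eq_zero.mp h ▸ hz)
  have hjump : ∀ i j, ∃ n, LogJump (fun z => (z - p i) / (z - p j)) K L (γ 0) (γ 1) n := by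
    intro i j
    refine (hasLogOn_div_of_isPreconnected hK.isClosed ht htK (hpt i) (hpt j)).exists_logJump
      (hasLogOn_arc hγ hinj ?_ ?_) ha hb
    · exact ContinuousOn.div (by fun_prop) (by fun_prop) fun z hz => hne j z (Or.inr hz)
    · exact fun z hz => div_ne_zero (hne i z (Or.inr hz)) (hne j z (Or.inr hz))
  obtain ⟨k, hk⟩ := hjump 0 1
  obtain ⟨l, hl⟩ := hjump 1 2
  obtain ⟨u, v, huv, huv0⟩ : ∃ u v : ℤ, u * k + v * l = 0 ∧ ¬ (u = 0 ∧ v = 0) := by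
    by_cases h : k = 0 ∧ l = 0
    · exact ⟨1, 0, by simp [h.1], by simp⟩
    · exact ⟨l, -k, by ring, fun h' => h ⟨neg_eq_zero.mp h'.2, h'.1⟩⟩
  have hlog := (huv ▸ hk.zpow_mul_zpow hl u v).hasLogOn_union hK.isClosed hLc.isClosed ha hKγ
  let m : Fin 3 → ℤ := ![u, v - u, -v]
  have hlog' : HasLogOn (fun z => ∏ i, (z - p i) ^ m i) (K ∪ L) := by
    refine hlog.congr fun z hz => ?_
    simp only [Fin.prod_univ_three, m, div_zpow, Matrix.cons_val_zero, Matrix.cons_val_one,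
      Matrix.cons_val, zpow_neg, zpow_sub₀ (hne 1 z hz)]
    ring
  have hzero : ∀ i, Bornology.IsBounded (connectedComponentIn (K ∪ L)ᶜ (p i)) → m i = 0 := by
    intro i hi
    have hne' : ∀ j ∈ Finset.univ.erase i,
        ∀ z ∈ connectedComponentIn (K ∪ L)ᶜ (p i) ∪ (K ∪ L), z - p j ≠ 0 := by
      rintro j hj z (hz | hz) h0
      · exact hp i j (Finset.ne_of_mem_erase hj).symm (sub_eq_zero.mp h0 ▸ hz)
      · exact hne j z hz h0
    refine exponent_eq_zero_of_hasLogOn hD (hpD i) hi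
      (q := fun z => ∏ j ∈ Finset.univ.erase i, (z - p j) ^ m j) ?_ ?_
      (hlog'.congr fun z _ => (Finset.mul_prod_erase _ _ (Finset.mem_univ i)).symm)
    · exact continuousOn_finsetProd _ fun j hj =>
        ContinuousOn.zpow₀ (by fun_prop) _ fun z hz => Or.inl (hne' j hj z hz)
    · exact fun z hz => Finset.prod_ne_zero_iff.mpr fun j hj => zpow_ne_zero _ (hne' j hj z hz)
  have hpair : ∀ i j, i ≠ j → m i = 0 ∨ m j = 0 := fun i j hij =>
    (isBounded_or_isBounded_connectedComponentIn hD.isBounded (hp i j hij) (hpD j)).imp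
      (hzero i) (hzero j)
  have h01 : u = 0 ∨ v - u = 0 := hpair 0 1 (by decide)
  have h02 : u = 0 ∨ -v = 0 := hpair 0 2 (by decide)
  have h12 : v - u = 0 ∨ -v = 0 := hpair 1 2 (by decide)
  omega

/-- A `C`-edge is incident with at most two faces of `H`. -/
theorem not_three_faces_incEdge {V : Type*} [Fintype V] {G : SimpleGraph V}
    (emb : PlaneEmbedding G) {x : V} (C : G.Walk x x) {e : Sym2 V} (he : e ∈ C.edges)
    {f : Fin 3 → Set (ℝ × ℝ)} (hf : ∀ i, IsFaceOf (drawingH emb C) (f i))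
    (hinc : ∀ i, incEdge emb (f i) e) (hinj : Function.Injective f) : False := by
  induction e using Sym2.ind with | _ u v
  have huv : G.Adj u v := C.adj_of_mem_edges he
  have hHuv : (Hgraph C).Adj u v := SimpleGraph.deleteEdges_adj.mpr ⟨huv, fun h => h.2.1 he⟩
  obtain ⟨γ, hγ, hγi, hγ0, hγ1, hγim⟩ := emb.arc_curve u v huv
  have hγne : ∀ r ∈ Set.Ioo (0 : ℝ) 1, γ r ∉ Set.range emb.pos := by
    rintro r hr ⟨w, hw⟩
    have hrI := Set.Ioo_subset_Icc_self hr
    rcases emb.arc_vertex u v huv w (hγim ▸ ⟨r, hrI, hw.symm⟩) with rfl | rfl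
    · exact hr.1.ne' (hγi hrI (by simp) (hw.symm.trans hγ0.symm))
    · exact hr.2.ne (hγi hrI (by simp) (hw.symm.trans hγ1.symm))
  let K : Set (ℝ × ℝ) := Set.range emb.pos ∪
    ⋃ (a : V) (b : V) (_ : (Hgraph C).Adj a b ∧ s(a, b) ≠ s(u, v)), emb.arc a b
  have hKarc : K ∩ emb.arc u v ⊆ Set.range emb.pos := by
    rintro z ⟨hz | hz, hzuv⟩
    · exact hz
    · simp only [Set.mem_iUnion] at hz
      obtain ⟨a, b, ⟨hab, hne⟩, hz⟩ := hz
      exact emb.arc_inter a b u v (SimpleGraph.deleteEdges_adj.mp hab).1 huv hne ⟨hz, hzuv⟩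
  have hK : IsCompact K := by
    refine (Set.finite_range _).isCompact.union ?_
    refine isCompact_iUnion fun a => isCompact_iUnion fun b => isCompact_iUnion fun hab => ?_
    obtain ⟨δ, hδ, -, -, -, hδim⟩ :=
      emb.arc_curve a b (SimpleGraph.deleteEdges_adj.mp hab.1).1
    exact hδim ▸ isCompact_Icc.image_of_continuousOn hδ
  have hD : drawingH emb C = K ∪ γ '' Set.Icc 0 1 := by
    rw [hγim]
    ext z
    simp only [drawingH, drawingOn, K, Set.image_univ, Set.mem_union, Set.mem_iUnion,
      Set.mem_univ, exists_prop, true_and, or_assoc]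
    refine or_congr_right ⟨?_, ?_⟩
    · rintro ⟨a, b, hab, hz⟩
      by_cases h : s(a, b) = s(u, v)
      · refine Or.inr ?_
        rcases Sym2.eq_iff.mp h with ⟨rfl, rfl⟩ | ⟨rfl, rfl⟩
        · exact hz
        · exact emb.arc_symm _ _ ▸ hz
      · exact Or.inl ⟨a, b, ⟨hab, h⟩, hz⟩
    · rintro (⟨a, b, ⟨hab, -⟩, hz⟩ | hz)
      · exact ⟨a, b, hab, hz⟩
      · exact ⟨u, v, hHuv, hz⟩
  choose z hz hfz using hf
  have hfD : ∀ i, f i ⊆ (drawingH emb C)ᶜ := fun i =>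
    hfz i ▸ connectedComponentIn_subset _ _
  have hzf : ∀ i, z i ∈ f i := fun i => hfz i ▸ mem_connectedComponentIn (hz i)
  have hArc : γ '' Set.Ioo 0 1 ⊆ emb.arc u v :=
    hγim ▸ Set.image_mono Set.Ioo_subset_Icc_self
  let T : Set (ℝ × ℝ) := ⋃ i, (f i ∪ γ '' Set.Ioo 0 1)
  have hT : IsPreconnected T := by
    refine isPreconnected_iUnion
      ⟨γ (1 / 2), Set.mem_iInter.mpr fun i => Or.inr ⟨1 / 2, by norm_num, rfl⟩⟩ fun i => ?_
    have hpre : IsPreconnected (f i) := hfz i ▸ isPreconnected_connectedComponentIn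
    exact hpre.subset_closure Set.subset_union_left
      (Set.union_subset subset_closure (hArc.trans (hinc i)))
  have hTK : T ⊆ Kᶜ := by
    refine Set.iUnion_subset fun i => Set.union_subset ?_ ?_
    · exact (hfD i).trans (Set.compl_subset_compl.mpr (hD ▸ Set.subset_union_left))
    · rintro _ ⟨r, hr, rfl⟩ hrK
      exact hγne r hr (hKarc ⟨hrK, hArc ⟨r, hr, rfl⟩⟩)
  let φ : ℝ × ℝ ≃ₜ ℂ := Complex.equivRealProdCLM.symm.toHomeomorph
  have himg : (fun r => φ (γ r)) '' Set.Icc 0 1 = φ '' (γ '' Set.Icc 0 1) :=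
    (Set.image_image _ _ _).symm
  refine not_three_components_of_arc (K := φ '' K) (t := φ '' T) (γ := fun r => φ (γ r))
    (p := fun i => φ (z i)) (hK.image φ.continuous) (φ.continuous.comp_continuousOn hγ)
    (φ.injective.comp_injOn hγi) ⟨_, Or.inl ⟨u, hγ0.symm⟩, rfl⟩ ⟨_, Or.inl ⟨v, hγ1.symm⟩, rfl⟩
    ?_ (hT.image _ φ.continuous.continuousOn) ?_ ?_ ?_ ?_
  · rw [himg, ← Set.image_inter φ.injective, ← Set.image_pair (f := φ)]
    refine Set.image_mono ?_
    rw [hγim]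
    intro y hy
    obtain ⟨w, rfl⟩ := hKarc hy
    rcases emb.arc_vertex u v huv w hy.2 with rfl | rfl
    · exact Or.inl hγ0.symm
    · exact Or.inr hγ1.symm
  · rw [← Set.image_compl_eq φ.bijective]
    exact Set.image_mono hTK
  · exact fun i => ⟨_, Set.mem_iUnion.mpr ⟨i, Or.inl (hzf i)⟩, rfl⟩
  · rintro i hi
    rw [himg, φ.injective.mem_set_image] at hi
    exact hz i (hD ▸ Or.inr hi)
  · intro i j hij hmem
    rw [himg, ← Set.image_union, ← hD, ← Set.image_compl_eq φ.bijective,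
      ← φ.image_connectedComponentIn (hz i), φ.injective.mem_set_image] at hmem
    exact hij (hinj ((hfz i).trans ((connectedComponentIn_eq hmem).trans (hfz j).symm)))

section Discharging

variable {V : Type*} [Fintype V] {G : SimpleGraph V} (emb : PlaneEmbedding G) {x : V}
  (C : G.Walk x x)

theorem sendWeight_nonneg (f f' : Set (ℝ × ℝ)) : 0 ≤ sendWeight emb C f f' := by
  unfold sendWeight
  positivity

/-- A major face sends weight only by the first rule. -/
theorem sendWeight_of_majorFaceH {f : Set (ℝ × ℝ)} (hf : MajorFaceH emb C f)
    (f' : Set (ℝ × ℝ)) :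
    sendWeight emb C f f' =
      if MinorFaceH emb C f' ∧ OppositeFaces emb C f f' then (mEdges emb C f f' : ℚ) else 0 := by
  simp [sendWeight, hf, hf.2]

/-- The minor faces opposite to a face have in total at most as many common `C`-edges with it
as it has `C`-edges. -/
theorem sum_mEdges_le_numCEdges {f : Set (ℝ × ℝ)} (hf : IsFaceOf (drawingH emb C) f)
    (s : Finset (Set (ℝ × ℝ))) (hs : ∀ f' ∈ s, IsFaceOf (drawingH emb C) f' ∧ f ≠ f') :
    ∑ f' ∈ s, mEdges emb C f f' ≤ numCEdges emb C f := by
  simp only [mEdges, numCEdges, ← Finset.filter_filter]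
  set E := C.edges.toFinset.filter fun e => incEdge emb f e
  refine (Finset.sum_card_bipartiteAbove_eq_sum_card_bipartiteBelow
    fun f' e => incEdge emb f' e).trans_le ?_
  rw [Finset.card_eq_sum_ones]
  refine Finset.sum_le_sum fun e he => Finset.card_le_one.mpr fun g hg g' hg' => ?_
  obtain ⟨heC, hfe⟩ := Finset.mem_filter.mp he
  obtain ⟨hgs, hge⟩ := Finset.mem_filter.mp hg
  obtain ⟨hgs', hge'⟩ := Finset.mem_filter.mp hg'
  by_contra hne
  refine not_three_faces_incEdge emb C (List.mem_toFinset.mp heC) (f := ![f, g, g']) ?_ ?_ ?_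
  · simp [Fin.forall_fin_succ, hf, hs g hgs, hs g' hgs']
  · simp [Fin.forall_fin_succ, hfe, hge, hge']
  · intro i j hij
    have h1 := (hs g hgs).2
    have h2 := (hs g' hgs').2
    clear hs
    fin_cases i <;> fin_cases j <;> simp_all

/-- A major face sends at most its initial charge. -/
theorem finsum_sendWeight_le_numCEdges {f : Set (ℝ × ℝ)} (hf : MajorFaceH emb C f) :
    ∑ᶠ f', sendWeight emb C f f' ≤ numCEdges emb C f := by
  by_cases hfin : (Function.support (sendWeight emb C f)).Finite
  · have hmem : ∀ f' ∈ hfin.toFinset, MinorFaceH emb C f' ∧ OppositeFaces emb C f f' := by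
      intro f' hf'
      rw [Set.Finite.mem_toFinset, Function.mem_support, sendWeight_of_majorFaceH emb C hf] at hf'
      exact (ite_ne_right_iff.mp hf').1
    rw [finsum_eq_sum _ hfin, Finset.sum_congr rfl fun f' hf' =>
      (sendWeight_of_majorFaceH emb C hf f').trans (if_pos (hmem f' hf'))]
    exact_mod_cast sum_mEdges_le_numCEdges emb C hf.1 _ fun f' hf' =>
      ⟨(hmem f' hf').1.1, (hmem f' hf').2.1⟩
  · rw [finsum_of_infinite_support hfin]
    positivity

end Discharging

/-- After discharging by rules R1–R5, every major face of `H` has weight `≥ 0`. -/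
theorem stmt7_major_face_nonneg
    {V : Type*} [Fintype V] {G : SimpleGraph V}
    (hn : 11 ≤ Fintype.card V) (h4 : EssentiallyFourConnected G)
    (emb : PlaneEmbedding G) {x : V} (C : G.Walk x x)
    (hC : IsLongestIsolatingCycle G C) (hc : 8 ≤ C.length)
    (hVm : (Vminus emb C).Nonempty) (hVp : (Vplus emb C).Nonempty) :
    ∀ f : Set (ℝ × ℝ), MajorFaceH emb C f → (0 : ℚ) ≤ wFace emb C f := by
  intro f hf
  have h1 := finsum_sendWeight_le_numCEdges emb C hf
  have h2 : 0 ≤ ∑ᶠ f', sendWeight emb C f' f := finsum_nonneg fun f' => sendWeight_nonneg emb C f' f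
  unfold wFace
  linarith

end
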